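/- (Ceva's Theorem, trigonometric/cevian form) Let A, B, C be three affinely independent points in the Euclidean plane and let O be a point not on any of the lines AB, BC, CA. Let D be the intersection of line AO with line BC, E the intersection of line BO with line AC, and F the intersection of line CO with line AB (assume these intersections exist). Then dist(B,D) · dist(C,E) · dist(A,F) = dist(D,C) · dist(E,A) · dist(F,B). -/

import Mathlib

/-- Twice the signed area of the triangle `P Q R`. -/
def signedArea (P Q R : ℂ) : ℝ :=
  (Q.re - P.re) * (R.im - P.im) - (Q.im - P.im) * (R.re - P.re)

theorem mem_affineSpan_of_signedArea_eq_zero {P Q R : ℂ} (hPQ : P ≠ Q)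
    (h : signedArea P Q R = 0) : R ∈ affineSpan ℝ ({P, Q} : Set ℂ) := by
  have hn : (Q.re - P.re) ^ 2 + (Q.im - P.im) ^ 2 ≠ 0 := by
    intro h0
    apply hPQ
    apply Complex.ext <;> nlinarith [sq_nonneg (Q.re - P.re), sq_nonneg (Q.im - P.im)]
  unfold signedArea at h
  have hR : R = AffineMap.lineMap P Q
      (((Q.re - P.re) * (R.re - P.re) + (Q.im - P.im) * (R.im - P.im)) /
        ((Q.re - P.re) ^ 2 + (Q.im - P.im) ^ 2)) := by
    apply Complex.ext
    · simp only [AffineMap.lineMap_apply, vsub_eq_sub, vadd_eq_add, Complex.add_re,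
        Complex.real_smul, Complex.re_ofReal_mul, Complex.sub_re]
      field_simp
      linear_combination -(Q.im - P.im) * h
    · simp only [AffineMap.lineMap_apply, vsub_eq_sub, vadd_eq_add, Complex.add_im,
        Complex.real_smul, Complex.im_ofReal_mul, Complex.sub_im]
      field_simp
      linear_combination (Q.re - P.re) * h
  rw [hR]
  exact AffineMap.lineMap_mem_affineSpan_pair _ _ _

theorem Collinear.exists_eq_lineMap {P Q R : ℂ} (hPQ : P ≠ Q)
    (h : Collinear ℝ ({P, Q, R} : Set ℂ)) : ∃ t : ℝ, R = AffineMap.lineMap P Q t := by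
  have hR : R ∈ affineSpan ℝ ({P, Q} : Set ℂ) :=
    h.mem_affineSpan_of_mem_of_ne (by simp) (by simp) (by simp) hPQ
  obtain ⟨t, ht⟩ := mem_affineSpan_pair_iff_exists_lineMap_eq.1 hR
  exact ⟨t, ht.symm⟩

/-- The foot of a cevian divides the opposite side in the ratio of the adjacent areas. -/
theorem exists_lineMap_of_cevian {A B C O D : ℂ} (hAO : A ≠ O) (hBC : B ≠ C)
    (hAOD : Collinear ℝ ({A, O, D} : Set ℂ)) (hBCD : Collinear ℝ ({B, C, D} : Set ℂ)) :
    ∃ d : ℝ, D = AffineMap.lineMap B C d ∧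
      (1 - d) * signedArea A B O = d * signedArea C A O := by
  obtain ⟨t, ht⟩ := hAOD.exists_eq_lineMap hAO
  obtain ⟨d, hd⟩ := hBCD.exists_eq_lineMap hBC
  refine ⟨d, hd, ?_⟩
  have hre := congrArg Complex.re (hd.symm.trans ht)
  have him := congrArg Complex.im (hd.symm.trans ht)
  simp only [AffineMap.lineMap_apply, vsub_eq_sub, vadd_eq_add, Complex.add_re,
    Complex.real_smul, Complex.re_ofReal_mul, Complex.sub_re, Complex.add_im,
    Complex.im_ofReal_mul, Complex.sub_im] at hre him
  unfold signedArea
  linear_combination (O.im - A.im) * hre - (O.re - A.re) * him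

/-- **Ceva's Theorem.** Let `A, B, C` be affinely independent and `O` a point on none of
the lines `AB`, `BC`, `CA`. If `D` is the intersection of line `AO` with line `BC`,
`E` that of line `BO` with line `AC`, and `F` that of line `CO` with line `AB`, then
`BD ⬝ CE ⬝ AF = DC ⬝ EA ⬝ FB` (unsigned lengths). -/
theorem ceva (A B C O D E F : ℂ)
    (h : AffineIndependent ℝ ![A, B, C])
    (hO : O ∉ affineSpan ℝ ({A, B} : Set ℂ) ∧ O ∉ affineSpan ℝ ({B, C} : Set ℂ) ∧
          O ∉ affineSpan ℝ ({C, A} : Set ℂ))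
    -- `D` is on line `AO` and on line `BC`:
    (hD : Collinear ℝ ({A, O, D} : Set ℂ) ∧ Collinear ℝ ({B, C, D} : Set ℂ))
    -- `E` is on line `BO` and on line `AC`:
    (hE : Collinear ℝ ({B, O, E} : Set ℂ) ∧ Collinear ℝ ({A, C, E} : Set ℂ))
    -- `F` is on line `CO` and on line `AB`:
    (hF : Collinear ℝ ({C, O, F} : Set ℂ) ∧ Collinear ℝ ({A, B, F} : Set ℂ)) :
    dist B D * dist C E * dist A F = dist D C * dist E A * dist F B := by
  obtain ⟨hAB, hBC, hCA⟩ := hO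
  have hne : A ≠ B ∧ B ≠ C ∧ C ≠ A :=
    ⟨h.injective.ne (show (0 : Fin 3) ≠ 1 by decide),
      h.injective.ne (show (1 : Fin 3) ≠ 2 by decide),
      h.injective.ne (show (2 : Fin 3) ≠ 0 by decide)⟩
  have hAO : A ≠ O := fun e => hAB (e ▸ left_mem_affineSpan_pair ℝ A B)
  have hBO : B ≠ O := fun e => hBC (e ▸ left_mem_affineSpan_pair ℝ B C)
  have hCO : C ≠ O := fun e => hCA (e ▸ left_mem_affineSpan_pair ℝ C A)
  have hz : signedArea A B O ≠ 0 := mt (mem_affineSpan_of_signedArea_eq_zero hne.1) hAB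
  have hx : signedArea B C O ≠ 0 := mt (mem_affineSpan_of_signedArea_eq_zero hne.2.1) hBC
  have hy : signedArea C A O ≠ 0 := mt (mem_affineSpan_of_signedArea_eq_zero hne.2.2) hCA
  obtain ⟨d, rfl, hd⟩ := exists_lineMap_of_cevian hAO hne.2.1 hD.1 hD.2
  obtain ⟨e, rfl, he⟩ := exists_lineMap_of_cevian hBO hne.2.2 hE.1
    (by rw [Set.insert_comm]; exact hE.2)
  obtain ⟨f, rfl, hf⟩ := exists_lineMap_of_cevian hCO hne.1 hF.1 hF.2
  have key : d * e * f = (1 - d) * (1 - e) * (1 - f) := by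
    apply mul_left_cancel₀ (mul_ne_zero (mul_ne_zero hx hy) hz)
    linear_combination (-(1 - e) * (1 - f) * signedArea B C O * signedArea C A O) * hd
      - d * (1 - f) * signedArea C A O * signedArea C A O * he
      - d * e * signedArea C A O * signedArea A B O * hf
  have key' : |d| * |e| * |f| = |1 - d| * |1 - e| * |1 - f| := by
    simp only [← abs_mul, key]
  simp only [dist_left_lineMap, dist_lineMap_right, Real.norm_eq_abs]
  linear_combination dist B C * dist C A * dist A B * key'
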